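/- Let 0 < m ≤ L, κ = L/m, and set the heavy-ball parameters α = 4/(√L + √m)² and β = ((√κ − 1)/(√κ + 1))². For λ ∈ [m, L], let Â(λ) = [[0, 1], [−β, 1 + β − αλ]]. Then for every λ ∈ [m, L], every integer t ≥ 0, and every v ∈ ℝ², ‖Â(λ)^t v‖ ≤ √κ · ‖v‖, where ‖·‖ is the Euclidean norm on ℝ². -/

import Mathlib

/-- Scaled Chebyshev-type sequence. -/
noncomputable def hbSeq (ρ θ : ℝ) : ℕ → ℝ
  | 0 => 0
  | n + 1 => ρ * Real.cos θ * hbSeq ρ θ n + ρ ^ n * Real.cos (n * θ)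

lemma hbSeq_sin (ρ θ : ℝ) (n : ℕ) :
    ρ * hbSeq ρ θ n * Real.sin θ = ρ ^ n * Real.sin (n * θ) := by
  induction n with
  | zero => simp [hbSeq]
  | succ n ih =>
    have h : ((n + 1 : ℕ) : ℝ) * θ = n * θ + θ := by push_cast; ring
    rw [h, Real.sin_add, hbSeq]
    linear_combination ρ * Real.cos θ * ih

lemma hbSeq_rec (ρ θ : ℝ) (n : ℕ) :
    hbSeq ρ θ (n + 2) = 2 * ρ * Real.cos θ * hbSeq ρ θ (n + 1) - ρ ^ 2 * hbSeq ρ θ n := by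
  have h : ((n + 1 : ℕ) : ℝ) * θ = n * θ + θ := by push_cast; ring
  have hs := hbSeq_sin ρ θ n
  have hq := Real.sin_sq_add_cos_sq θ
  rw [hbSeq, h, Real.cos_add, hbSeq]
  linear_combination ρ * Real.sin θ * hs - ρ ^ 2 * hbSeq ρ θ n * hq

lemma hbSeq_bound (ρ θ : ℝ) (hρ : 0 ≤ ρ) (n : ℕ) :
    |hbSeq ρ θ (n + 1)| ≤ (n + 1) * ρ ^ n := by
  induction n with
  | zero => simp [hbSeq]
  | succ n ih =>
    rw [hbSeq]
    have hp : 0 ≤ ρ ^ (n + 1) := by positivity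
    calc _ ≤ |ρ * Real.cos θ * hbSeq ρ θ (n + 1)|
          + |ρ ^ (n + 1) * Real.cos ((n + 1 : ℕ) * θ)| := abs_add_le _ _
      _ = |Real.cos θ| * (ρ * |hbSeq ρ θ (n + 1)|)
          + ρ ^ (n + 1) * |Real.cos ((n + 1 : ℕ) * θ)| := by
          rw [abs_mul, abs_mul, abs_mul, abs_of_nonneg hρ, abs_of_nonneg hp]; ring
      _ ≤ 1 * (ρ * ((n + 1) * ρ ^ n)) + ρ ^ (n + 1) * 1 := by
          gcongr
          · exact Real.abs_cos_le_one _
          · exact Real.abs_cos_le_one _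
      _ = _ := by push_cast; ring

lemma hb_pow (ρ θ : ℝ) (n : ℕ) :
    (!![0, 1; -ρ ^ 2, 2 * ρ * Real.cos θ] : Matrix (Fin 2) (Fin 2) ℝ) ^ (n + 1)
      = !![-ρ ^ 2 * hbSeq ρ θ n, hbSeq ρ θ (n + 1);
          -ρ ^ 2 * hbSeq ρ θ (n + 1), hbSeq ρ θ (n + 2)] := by
  induction n with
  | zero =>
    rw [hbSeq_rec]
    simp [hbSeq]
  | succ n ih =>
    rw [pow_succ, ih, hbSeq_rec ρ θ (n + 1), hbSeq_rec ρ θ n, Matrix.mul_fin_two]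
    ext i j
    fin_cases i <;> fin_cases j <;> simp <;> ring

lemma hb_row (p q S x y : ℝ) (h1 : |p| + |q| ≤ S) :
    (p * x + q * y) ^ 2 ≤ S * (|p| * x ^ 2 + |q| * y ^ 2) := by
  have h : (p * x + q * y) ^ 2 ≤ (|p| + |q|) * (|p| * x ^ 2 + |q| * y ^ 2) := by
    have hpq : p * q * (x * y) * 2 ≤ |p| * |q| * (x ^ 2 + y ^ 2) := by
      have h1 : p * q * (x * y) ≤ |p| * |q| * (|x| * |y|) := by
        rw [← abs_mul, ← abs_mul, ← abs_mul]; exact le_abs_self _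
      have h2 : 2 * (|x| * |y|) ≤ x ^ 2 + y ^ 2 := by
        rw [← sq_abs x, ← sq_abs y]; nlinarith [sq_nonneg (|x| - |y|)]
      nlinarith [mul_le_mul_of_nonneg_left h2 (by positivity : 0 ≤ |p| * |q|)]
    nlinarith [sq_abs p, sq_abs q]
  exact h.trans (mul_le_mul_of_nonneg_right h1 (by positivity))

lemma hb_schur (p q r w S x y : ℝ) (h1 : |p| + |q| ≤ S) (h2 : |r| + |w| ≤ S)
    (h3 : |p| + |r| ≤ S) (h4 : |q| + |w| ≤ S) :
    (p * x + q * y) ^ 2 + (r * x + w * y) ^ 2 ≤ S ^ 2 * (x ^ 2 + y ^ 2) := by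
  have hS : 0 ≤ S := le_trans (by positivity) h1
  have a := hb_row p q S x y h1
  have b := hb_row r w S x y h2
  have c := mul_le_mul_of_nonneg_left h3 (by positivity : 0 ≤ S * x ^ 2)
  have d := mul_le_mul_of_nonneg_left h4 (by positivity : 0 ≤ S * y ^ 2)
  nlinarith

lemma hb_geom (ρ : ℝ) (h0 : 0 ≤ ρ) (h1 : ρ ≤ 1) (n : ℕ) :
    (1 - ρ) * ((n + 1) * ρ ^ n) ≤ 1 - ρ ^ (n + 1) := by
  induction n with
  | zero => simp
  | succ n ih =>
    have h2 := mul_le_mul_of_nonneg_left ih h0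
    have : ρ ^ (n + 1) = ρ * ρ ^ n := by ring
    have : ρ ^ (n + 1 + 1) = ρ * (ρ * ρ ^ n) := by ring
    have hp : ρ * ρ ^ n ≤ 1 := by
      rw [← pow_succ']; exact pow_le_one₀ h0 h1
    have h3 := mul_nonneg (sub_nonneg.2 h1) (sub_nonneg.2 hp)
    push_cast
    simp only [*] at *
    nlinarith

lemma hb_main (ρ θ : ℝ) (h0 : 0 ≤ ρ) (h1 : ρ < 1) (n : ℕ) (x y : ℝ) :
    (-ρ ^ 2 * hbSeq ρ θ n * x + hbSeq ρ θ (n + 1) * y) ^ 2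
      + (-ρ ^ 2 * hbSeq ρ θ (n + 1) * x + hbSeq ρ θ (n + 2) * y) ^ 2
      ≤ ((1 + ρ) / (1 - ρ)) ^ 2 * (x ^ 2 + y ^ 2) := by
  have hd : 0 < 1 - ρ := by linarith
  have e1 : |-ρ ^ 2 * hbSeq ρ θ n| ≤ n * ρ ^ n * ρ := by
    rw [abs_mul, abs_neg, abs_of_nonneg (by positivity : 0 ≤ ρ ^ 2)]
    cases n with
    | zero => simp [hbSeq]
    | succ k =>
      have := mul_le_mul_of_nonneg_left (hbSeq_bound ρ θ h0 k) (by positivity : 0 ≤ ρ ^ 2)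
      refine this.trans (le_of_eq ?_)
      push_cast; ring
  have e2 := hbSeq_bound ρ θ h0 n
  have e3 : |-ρ ^ 2 * hbSeq ρ θ (n + 1)| ≤ ρ ^ 2 * ((n + 1) * ρ ^ n) := by
    rw [abs_mul, abs_neg, abs_of_nonneg (by positivity : 0 ≤ ρ ^ 2)]
    gcongr
  have e4 : |hbSeq ρ θ (n + 2)| ≤ ρ * ((n + 1) * ρ ^ n) + ρ * ρ ^ n := by
    refine (hbSeq_bound ρ θ h0 (n + 1)).trans (le_of_eq ?_)
    push_cast; ring
  have g := hb_geom ρ h0 h1.le n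
  rw [pow_succ] at g
  have hP : 0 ≤ ρ ^ n := by positivity
  have e1' : |-ρ ^ 2 * hbSeq ρ θ n| ≤ ρ * ((n + 1) * ρ ^ n) - ρ * ρ ^ n := by
    refine e1.trans (le_of_eq ?_); ring
  set P := ρ ^ n
  set T := ((n : ℝ) + 1) * P
  have hT : 0 ≤ T := by positivity
  have hρP : 0 ≤ ρ * P := by positivity
  have hρT : 0 ≤ ρ * T := by positivity
  have g2 := mul_le_mul_of_nonneg_left g h0
  have k1 : ρ * ρ * P ≤ ρ * P := by nlinarith
  have k2 : ρ * ρ * P ≥ 0 := by positivity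
  have key : T + (ρ * T + ρ * P) ≤ (1 + ρ) / (1 - ρ) := by
    rw [le_div_iff₀ hd]; nlinarith
  have k3 : ρ ^ 2 * T ≤ ρ * T := by nlinarith
  have k4 : ρ * T ≤ T := by nlinarith
  apply hb_schur <;> linarith

theorem stmt_13 (m L : ℝ) (hm : 0 < m) (hmL : m ≤ L)
    (κ α β : ℝ) (hκ : κ = L / m)
    (hα : α = 4 / (Real.sqrt L + Real.sqrt m) ^ 2)
    (hβ : β = ((Real.sqrt κ - 1) / (Real.sqrt κ + 1)) ^ 2)
    (A : ℝ → Matrix (Fin 2) (Fin 2) ℝ)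
    (hA : ∀ lam : ℝ, A lam = !![0, 1; -β, 1 + β - α * lam]) :
    ∀ lam ∈ Set.Icc m L, ∀ (t : ℕ) (v : EuclideanSpace ℝ (Fin 2)),
      ‖Matrix.toEuclideanLin (A lam ^ t) v‖ ≤ Real.sqrt κ * ‖v‖ := by
  rintro lam ⟨hl1, hl2⟩ t v
  have hL : 0 < L := hm.trans_le hmL
  obtain ⟨a, ha⟩ : ∃ a, a = Real.sqrt m := ⟨_, rfl⟩
  obtain ⟨b, hb⟩ : ∃ b, b = Real.sqrt L := ⟨_, rfl⟩
  have ha0 : 0 < a := ha ▸ Real.sqrt_pos.2 hm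
  have hb0 : 0 < b := hb ▸ Real.sqrt_pos.2 hL
  have hab : a ≤ b := by rw [ha, hb]; exact Real.sqrt_le_sqrt hmL
  have ham : a ^ 2 = m := by rw [ha]; exact Real.sq_sqrt hm.le
  have hbL : b ^ 2 = L := by rw [hb]; exact Real.sq_sqrt hL.le
  have hs : Real.sqrt κ = b / a := by rw [hκ, Real.sqrt_div hL.le, ha, hb]
  obtain ⟨ρ, hρ⟩ : ∃ ρ, ρ = (b - a) / (b + a) := ⟨_, rfl⟩
  have hρ0 : 0 ≤ ρ := by rw [hρ]; apply div_nonneg <;> linarith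
  have hρ1 : ρ < 1 := by rw [hρ, div_lt_one (by linarith)]; linarith
  have hβρ : β = ρ ^ 2 := by
    rw [hβ, hs, hρ]; congr 1; field_simp
  have hsρ : Real.sqrt κ = (1 + ρ) / (1 - ρ) := by
    have : (1 - ρ) ≠ 0 := by linarith
    rw [hs, div_eq_div_iff ha0.ne' this, hρ]; field_simp; ring
  have hα' : α = 4 / (b + a) ^ 2 := by rw [hα, ha, hb]
  have hmin : α * lam ≥ (1 - ρ) ^ 2 := by
    have : (1 - ρ) ^ 2 = 4 / (b + a) ^ 2 * m := by rw [hρ, ← ham]; field_simp; ring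
    rw [this, hα']; gcongr
  have hmax : α * lam ≤ (1 + ρ) ^ 2 := by
    have : (1 + ρ) ^ 2 = 4 / (b + a) ^ 2 * L := by rw [hρ, ← hbL]; field_simp; ring
    rw [this, hα']; gcongr
  obtain ⟨θ, hθ⟩ : ∃ θ, 1 + β - α * lam = 2 * ρ * Real.cos θ := by
    rcases hρ0.eq_or_lt with h | h
    · refine ⟨0, ?_⟩
      rw [hβρ]; rw [← h] at hmin hmax ⊢; linarith
    · refine ⟨Real.arccos ((1 + β - α * lam) / (2 * ρ)), ?_⟩
      rw [Real.cos_arccos]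
      · field_simp
      · rw [le_div_iff₀ (by positivity), hβρ]; nlinarith
      · rw [div_le_iff₀ (by positivity), hβρ]; nlinarith
  have hs1 : 1 ≤ Real.sqrt κ := by rw [hs, one_le_div ha0]; exact hab
  cases t with
  | zero =>
    have : ‖Matrix.toEuclideanLin (A lam ^ 0) v‖ = ‖v‖ := by simp
    rw [this]
    exact le_mul_of_one_le_left (norm_nonneg _) hs1
  | succ n =>
    rw [hA, hθ, hβρ, hb_pow]
    apply le_of_sq_le_sq _ (by positivity)
    rw [mul_pow, EuclideanSpace.norm_sq_eq, EuclideanSpace.norm_sq_eq, hsρ]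
    have := hb_main ρ θ hρ0 hρ1 n (v 0) (v 1)
    simpa [Fin.sum_univ_two, Matrix.toLpLin_apply, Matrix.mulVec, dotProduct] using this
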